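/- arXiv:2306.00744 — 5 statements merged into one kernel-verified Lean document; each statement's English description precedes it below -/
import Mathlib

section
/- Let α, β, γ be the explicit functions α(t) = t(1+m/(2t))²·[(C₂c_p + C₁(a/m)·I_a(m/(2t))/I_a(m/(2r₀)))·η(t) − C₁/m], β(t) = −η(t)α(t) + (C₂c_p·m/a + C₁·I_a(m/(2t))/I_a(m/(2r₀)))·c_p^{−2} t^{2a}(1+m/(2t))^{4a}, γ(t) = −c_p² t^{−2a}(1+m/(2t))^{−4a} η(t)α(t) − (C₂c_p·m/a + C₁·I_a(m/(2t))/I_a(m/(2r₀))) + C₃. Then α, β, γ are differentiable on (|m|/2, ∞) and satisfy there the system of ODEs: α'(t) − (2a+1)η(t)f'(t)α(t) − a f'(t)β(t) = 0, β'(t) + (2a+1)η(t)² f'(t)α(t) = 0, and γ'(t) + f'(t)α(t) = 0, where f'(t) = c_p t^{−a−1}(1+m/(2t))^{−2a}. -/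
open Real MeasureTheory Set Filter

/-- The mass integral `∫₀ˣ s^(a-1) (1 + σ s)^(-2a) ds` is differentiable in its upper limit on
`(0, 1)`. -/
lemma hasDerivAt_integral_rpow_mul_one_add_rpow {a σ x : ℝ} (ha : 0 < a) (hσ : -1 ≤ σ)
    (hx : 0 < x) (hx1 : x < 1) :
    HasDerivAt (fun u : ℝ => ∫ s in (0:ℝ)..u, s ^ (a - 1) * (1 + σ * s) ^ (-(2 * a)))
      (x ^ (a - 1) * (1 + σ * x) ^ (-(2 * a))) x := by
  have hpos : ∀ s : ℝ, 0 ≤ s → s ≤ x → 0 < 1 + σ * s := fun s h0 h1 => by nlinarith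
  have hmeas : Measurable fun s : ℝ => s ^ (a - 1) * (1 + σ * s) ^ (-(2 * a)) := by fun_prop
  refine intervalIntegral.integral_hasDerivAt_right ?_
    hmeas.stronglyMeasurable.stronglyMeasurableAtFilter ?_
  · refine (intervalIntegral.intervalIntegrable_rpow' (by linarith)).mul_continuousOn ?_
    rw [uIcc_of_le hx.le]
    exact ContinuousOn.rpow_const (by fun_prop) fun s hs => Or.inl (hpos s hs.1 hs.2).ne'
  · exact (continuousAt_id.rpow_const (Or.inl hx.ne')).mul
      (ContinuousAt.rpow_const (by fun_prop) (Or.inl (hpos x hx.le le_rfl).ne'))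

lemma abs_div_two_mul_lt_one {m t : ℝ} (ht : |m| / 2 < t) : |m| / (2 * t) < 1 := by
  have := abs_nonneg m
  rw [div_lt_one (by linarith)]
  linarith

lemma one_add_div_two_mul_pos {m t : ℝ} (ht : |m| / 2 < t) : 0 < 1 + m / (2 * t) := by
  have h0 := abs_nonneg m
  have h1 := abs_div_two_mul_lt_one ht
  have h2 : -(|m| / (2 * t)) ≤ m / (2 * t) := by
    rw [← neg_div]
    exact div_le_div_of_nonneg_right (neg_abs_le m) (by linarith)
  linarith

lemma real_sign_div_two_mul {m t : ℝ} (ht : 0 < t) : Real.sign (m / (2 * t)) = Real.sign m := by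
  rcases lt_trichotomy m 0 with h | h | h
  · rw [Real.sign_of_neg h, Real.sign_of_neg (div_neg_of_neg_of_pos h (by linarith))]
  · simp [h]
  · rw [Real.sign_of_pos h, Real.sign_of_pos (by positivity)]

lemma abs_div_two_mul {m t : ℝ} (ht : 0 < t) : |m / (2 * t)| = |m| / (2 * t) := by
  rw [abs_div, abs_of_pos (by linarith : 0 < 2 * t)]

lemma hasDerivAt_div_two_mul (m : ℝ) {t : ℝ} (ht : t ≠ 0) :
    HasDerivAt (fun s : ℝ => m / (2 * s)) (-(m / (2 * t)) / t) t := by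
  have h := (hasDerivAt_const t m).div ((hasDerivAt_id t).const_mul 2) (by simpa using ht)
  refine h.congr_deriv ?_
  simp only [id]
  field_simp
  ring

/-- The mass normalization turns the derivative of the mass ratio into minus the derivative of the
model potential. -/
lemma hasDerivAt_mass_ratio {a c m r₀ t : ℝ} (ha : 0 < a) (hc : 0 < c) (hm : m ≠ 0)
    (hr₀pos : 0 < m → m / 2 ≤ r₀) (hr₀neg : m < 0 → |m| / 2 < r₀) {Ia : ℝ → ℝ}
    (hIa : ∀ k : ℝ, Ia k =
      ∫ s in (0:ℝ)..|k|, s ^ (a - 1) * (1 + Real.sign k * s) ^ (-(2 * a)))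
    (hmass : |m| = 2 * (c * Ia (m / (2 * r₀))) ^ (1 / a)) (ht : |m| / 2 < t) :
    HasDerivAt (fun s => Ia (m / (2 * s)) / Ia (m / (2 * r₀)))
      (-(c * t ^ (-a - 1) * (1 + m / (2 * t)) ^ (-(2 * a)))) t := by
  have hm0 : 0 < |m| := abs_pos.2 hm
  have ht0 : 0 < t := by linarith
  have hnonneg : 0 ≤ Ia (m / (2 * r₀)) := by
    rw [hIa]
    refine intervalIntegral.integral_nonneg (abs_nonneg _) fun s hs => ?_
    refine mul_nonneg (rpow_nonneg hs.1 _) (rpow_nonneg ?_ _)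
    rcases lt_or_gt_of_ne hm with h | h
    · have hr := hr₀neg h
      have hr0 : 0 < r₀ := by linarith
      have h1 := abs_div_two_mul_lt_one hr
      have h2 := hs.2
      rw [abs_div_two_mul hr0] at h2
      rw [real_sign_div_two_mul hr0, Real.sign_of_neg h]
      linarith
    · have hr0 : 0 < r₀ := by linarith [hr₀pos h]
      rw [real_sign_div_two_mul hr0, Real.sign_of_pos h]
      linarith [hs.1]
  have hne : Ia (m / (2 * r₀)) ≠ 0 := by
    intro h
    rw [h, mul_zero, zero_rpow (by positivity)] at hmass
    linarith
  have hnorm : (|m| / 2) ^ a = c * Ia (m / (2 * r₀)) := by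
    have : |m| / 2 = (c * Ia (m / (2 * r₀))) ^ (1 / a) := by linarith
    rw [this, ← rpow_mul (mul_nonneg hc.le hnonneg), one_div_mul_cancel ha.ne', rpow_one]
  have hx : 0 < |m| / (2 * t) := by positivity
  have hσ : -1 ≤ Real.sign m := by
    rcases Real.sign_apply_eq m with h | h | h <;> rw [h] <;> norm_num
  have hd := (hasDerivAt_integral_rpow_mul_one_add_rpow ha hσ hx
    (abs_div_two_mul_lt_one ht)).comp t (hasDerivAt_div_two_mul |m| ht0.ne')
  have hev : (fun s => Ia (m / (2 * s))) =ᶠ[nhds t]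
      (fun u : ℝ => ∫ s in (0:ℝ)..u, s ^ (a - 1) * (1 + Real.sign m * s) ^ (-(2 * a))) ∘
        fun s : ℝ => |m| / (2 * s) := by
    filter_upwards [lt_mem_nhds ht0] with s hs
    simp only [Function.comp]
    rw [hIa, real_sign_div_two_mul hs, abs_div_two_mul hs]
  refine ((hd.congr_of_eventuallyEq hev).div_const _).congr_deriv ?_
  have hk : Real.sign m * (|m| / (2 * t)) = m / (2 * t) := by
    rw [← mul_div_assoc]
    congr 1
    rcases lt_or_gt_of_ne hm with h | h
    · rw [Real.sign_of_neg h, abs_of_neg h, neg_one_mul, neg_neg]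
    · rw [Real.sign_of_pos h, abs_of_pos h, one_mul]
  have hp : (|m| / (2 * t)) ^ (a - 1) * (|m| / (2 * t)) = c * Ia (m / (2 * r₀)) * t ^ (-a) := by
    rw [rpow_sub_one hx.ne', div_mul_cancel₀ _ hx.ne', ← div_div, div_rpow (by positivity) ht0.le,
      hnorm, rpow_neg ht0.le, div_eq_mul_inv]
  rw [hk, rpow_sub_one ht0.ne']
  calc _ = -((|m| / (2 * t)) ^ (a - 1) * (|m| / (2 * t))) * (1 + m / (2 * t)) ^ (-(2 * a)) / t
        / Ia (m / (2 * r₀)) := by ring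
    _ = _ := by rw [hp]; field_simp

/-- The logarithmic derivative of `c⁻¹ t^a (1 + m/(2t))^(2a)`. -/
lemma hasDerivAt_conformal_rpow (a c : ℝ) {m t : ℝ} (ht0 : 0 < t) (hk : 0 < 1 + m / (2 * t)) :
    HasDerivAt (fun s => c⁻¹ * s ^ a * (1 + m / (2 * s)) ^ (2 * a))
      (a / t * ((1 - m / (2 * t)) / (1 + m / (2 * t))) *
        (c⁻¹ * t ^ a * (1 + m / (2 * t)) ^ (2 * a))) t := by
  have h1 := (Real.hasDerivAt_rpow_const (p := a) (Or.inl ht0.ne')).const_mul c⁻¹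
  have h2 := ((hasDerivAt_div_two_mul m ht0.ne').const_add 1).rpow_const (p := 2 * a)
    (Or.inl hk.ne')
  refine (h1.mul h2).congr_deriv ?_
  rw [rpow_sub_one ht0.ne', rpow_sub_one hk.ne']
  generalize t ^ a = A
  generalize (1 + m / (2 * t)) ^ (2 * a) = B
  generalize m / (2 * t) = k at *
  field_simp
  ring

/-- The explicit functions α, β, γ built from the Schwarzschild model data are
differentiable on (|m|/2, ∞) and satisfy the system of ODEs
α' − (2a+1)η f' α − a f' β = 0, β' + (2a+1)η² f' α = 0, γ' + f' α = 0. -/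
theorem schwarzschild_ode_system
    (p a : ℝ) (hp1 : 1 < p) (hp3 : p < 3) (ha : a = (3 - p) / (p - 1))
    (C₁ C₂ C₃ c_p m r₀ : ℝ) (hc : 0 < c_p) (hm : m ≠ 0)
    (hr₀pos : 0 < m → m / 2 ≤ r₀) (hr₀neg : m < 0 → |m| / 2 < r₀)
    (Ia : ℝ → ℝ)
    (hIa : ∀ k : ℝ, Ia k =
      ∫ s in (0:ℝ)..|k|, s ^ (a - 1) * (1 + Real.sign k * s) ^ (-(2 * a)))
    (hmass : |m| = 2 * (c_p * Ia (m / (2 * r₀))) ^ (1 / a))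
    (η f' α β γ : ℝ → ℝ)
    (hη : ∀ t, η t = c_p⁻¹ * t ^ a * (1 + m / (2 * t)) ^ (2 * a - 1) * (1 - m / (2 * t)))
    (hf' : ∀ t, f' t = c_p * t ^ (-a - 1) * (1 + m / (2 * t)) ^ (-(2 * a)))
    (hα : ∀ t, α t = t * (1 + m / (2 * t)) ^ (2 : ℕ) *
      ((C₂ * c_p + C₁ * (a / m) * (Ia (m / (2 * t)) / Ia (m / (2 * r₀)))) * η t - C₁ / m))
    (hβ : ∀ t, β t = -η t * α t +
      (C₂ * c_p * m / a + C₁ * (Ia (m / (2 * t)) / Ia (m / (2 * r₀)))) *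
        (c_p ^ (2 : ℕ))⁻¹ * t ^ (2 * a) * (1 + m / (2 * t)) ^ (4 * a))
    (hγ : ∀ t, γ t = -(c_p ^ (2 : ℕ)) * t ^ (-(2 * a)) * (1 + m / (2 * t)) ^ (-(4 * a)) *
        η t * α t -
      (C₂ * c_p * m / a + C₁ * (Ia (m / (2 * t)) / Ia (m / (2 * r₀)))) + C₃) :
    ∀ t ∈ Set.Ioi (|m| / 2),
      HasDerivAt α ((2 * a + 1) * η t * f' t * α t + a * f' t * β t) t ∧
      HasDerivAt β (-((2 * a + 1) * (η t) ^ (2 : ℕ) * f' t * α t)) t ∧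
      HasDerivAt γ (-(f' t * α t)) t := by
  intro t ht
  have ha0 : 0 < a := by rw [ha]; exact div_pos (by linarith) (by linarith)
  have htm : |m| / 2 < t := ht
  have hm0 : 0 < |m| := abs_pos.2 hm
  have ht0 : 0 < t := by linarith
  have hk := one_add_div_two_mul_pos htm
  set P : ℝ → ℝ := fun s => c_p⁻¹ * s ^ a * (1 + m / (2 * s)) ^ (2 * a) with hPdef
  set h : ℝ → ℝ := fun s => (1 - m / (2 * s)) / (1 + m / (2 * s)) with hhdef
  set U : ℝ → ℝ := fun s =>
    C₂ * c_p * m / a + C₁ * (Ia (m / (2 * s)) / Ia (m / (2 * r₀))) with hUdef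
  set g : ℝ → ℝ := fun s => s * (1 + m / (2 * s)) ^ (2 : ℕ) with hgdef
  have hPpos : ∀ s, |m| / 2 < s → 0 < P s := fun s hs => by
    have h1 := one_add_div_two_mul_pos hs
    have h2 : 0 < s := by linarith
    simp only [hPdef]
    positivity
  have hηP : ∀ s, |m| / 2 < s → η s = P s * h s := fun s hs => by
    have h1 := one_add_div_two_mul_pos hs
    rw [hη, rpow_sub_one h1.ne']
    simp only [hPdef, hhdef]
    ring
  have hP2 : ∀ s, |m| / 2 < s →
      (c_p ^ (2 : ℕ))⁻¹ * s ^ (2 * a) * (1 + m / (2 * s)) ^ (4 * a) = P s ^ 2 := fun s hs => by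
    have h1 := one_add_div_two_mul_pos hs
    have h2 : 0 < s := by linarith
    rw [show 2 * a = a * (2 : ℕ) by push_cast; ring,
      show 4 * a = (2 * a) * (2 : ℕ) by push_cast; ring, rpow_mul_natCast h2.le,
      rpow_mul_natCast h1.le]
    simp only [hPdef]
    ring
  have hP2inv : ∀ s, |m| / 2 < s →
      c_p ^ (2 : ℕ) * s ^ (-(2 * a)) * (1 + m / (2 * s)) ^ (-(4 * a)) = (P s ^ 2)⁻¹ :=
    fun s hs => by
    have h1 := one_add_div_two_mul_pos hs
    have h2 : 0 < s := by linarith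
    rw [← hP2 s hs, rpow_neg h2.le, rpow_neg h1.le]
    simp only [mul_inv, inv_inv]
  have hαP : ∀ s, |m| / 2 < s → α s = g s / m * (a * U s * (P s * h s) - C₁) := fun s hs => by
    rw [hα, hηP s hs]
    simp only [hUdef, hgdef]
    field_simp
  have hβP : ∀ s, |m| / 2 < s → β s = -(P s * h s) * α s + U s * P s ^ 2 := fun s hs => by
    rw [hβ, hηP s hs, ← hP2 s hs]
    simp only [hUdef]
    ring
  have hγP : ∀ s, |m| / 2 < s →
      γ s = -((P s ^ 2)⁻¹ * (P s * h s) * α s) - U s + C₃ := fun s hs => by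
    rw [hγ, hηP s hs, ← hP2inv s hs]
    simp only [hUdef]
    ring
  have hft : f' t = (t * P t)⁻¹ := by
    rw [hf', rpow_sub_one ht0.ne', rpow_neg ht0.le, rpow_neg hk.le]
    simp only [hPdef, mul_inv, inv_inv]
    ring
  have hPt := hPpos t htm
  have dP : HasDerivAt P (a / t * h t * P t) t := hasDerivAt_conformal_rpow a c_p ht0 hk
  have dk := hasDerivAt_div_two_mul m ht0.ne'
  have dg : HasDerivAt g (g t * h t / t) t := by
    refine ((hasDerivAt_id t).mul ((dk.const_add 1).pow 2)).congr_deriv ?_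
    simp only [hgdef, hhdef, id, Pi.pow_apply]
    generalize m / (2 * t) = k at *
    field_simp
    norm_num
    ring
  have hgt : 0 < g t := by
    simp only [hgdef]
    positivity
  have dh : HasDerivAt h (m / (g t * t)) t := by
    refine ((dk.const_sub 1).div (dk.const_add 1) hk.ne').congr_deriv ?_
    have hmk : m = 2 * t * (m / (2 * t)) := by field_simp
    simp only [hgdef]
    generalize m / (2 * t) = k at *
    rw [hmk]
    field_simp
    ring
  have dU : HasDerivAt U (-(C₁ * f' t)) t := by
    refine (((hasDerivAt_mass_ratio ha0 hc hm hr₀pos hr₀neg hIa hmass htm).const_mul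
      C₁).const_add _).congr_deriv ?_
    rw [hf']
    ring
  have hgh : h t ^ 2 * g t = g t - 2 * m := by
    have hmk : m = 2 * t * (m / (2 * t)) := by field_simp
    simp only [hgdef, hhdef]
    generalize m / (2 * t) = k at *
    rw [hmk]
    field_simp
    ring
  have hnhds : ∀ᶠ s in nhds t, |m| / 2 < s := lt_mem_nhds htm
  have dα : HasDerivAt α ((2 * a + 1) * η t * f' t * α t + a * f' t * β t) t := by
    refine ((((dg.div_const m).mul (((dU.const_mul a).mul (dP.mul dh)).sub_const
      C₁))).congr_of_eventuallyEq (hnhds.mono hαP)).congr_deriv ?_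
    simp only [Pi.mul_apply]
    rw [hβP t htm, hηP t htm, hαP t htm, hft]
    generalize P t = p₁ at *
    generalize h t = h₁ at *
    generalize U t = u₁ at *
    generalize g t = g₁ at *
    field_simp
    ring
  refine ⟨dα, ?_, ?_⟩
  · refine ((((dP.mul dh).neg.mul dα).add (dU.mul (dP.pow 2))).congr_of_eventuallyEq
      (hnhds.mono hβP)).congr_deriv ?_
    simp only [Pi.mul_apply, Pi.neg_apply, Pi.pow_apply]
    rw [hβP t htm, hηP t htm, hαP t htm, hft]
    generalize P t = p₁ at *
    generalize h t = h₁ at *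
    generalize U t = u₁ at *
    generalize g t = g₁ at *
    field_simp
    norm_num
    ring
  · refine (((((((dP.pow 2).inv (pow_ne_zero 2 hPt.ne')).mul (dP.mul dh)).mul dα).neg.sub
      dU).add_const C₃).congr_of_eventuallyEq (hnhds.mono hγP)).congr_deriv ?_
    simp only [Pi.mul_apply, Pi.inv_apply, Pi.pow_apply]
    rw [hβP t htm, hηP t htm, hαP t htm, hft]
    generalize P t = p₁ at *
    generalize h t = h₁ at *
    generalize U t = u₁ at *
    generalize g t = g₁ at *
    field_simp
    norm_num
    linear_combination p₁ * (C₁ - a * u₁ * h₁ * p₁) * hgh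
end

section
/- Let α(t) = t(1+m/(2t))²·[(C₂c_p + C₁(a/m)·I_a(m/(2t))/I_a(m/(2r₀)))·η(t) − C₁/m]. Then α(t) ≥ 0 for every t ∈ [r₀, +∞) if and only if C₂ ≥ 0 and (C₂c_p + C₁·a/m)·η(r₀) ≥ C₁/m. -/
open Real MeasureTheory Set Filter

theorem one_add_mul_pos_of_sq_eq_one {σ u : ℝ} (hσ : σ ^ 2 = 1) (hu : u ∈ Ico (0 : ℝ) 1) :
    0 < 1 + σ * u := by
  rcases sq_eq_one_iff.mp hσ with rfl | rfl <;> linarith [hu.1, hu.2]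

theorem one_sub_mul_pos_of_sq_eq_one {σ u : ℝ} (hσ : σ ^ 2 = 1) (hu : u ∈ Ico (0 : ℝ) 1) :
    0 < 1 - σ * u := by
  rcases sq_eq_one_iff.mp hσ with rfl | rfl <;> linarith [hu.1, hu.2]

/-- The primitive `∫₀ᵘ s^(a-1) (1 + σ s)^(-2a) ds`. -/
noncomputable def massIntegral (a σ u : ℝ) : ℝ :=
  ∫ s in (0 : ℝ)..u, s ^ (a - 1) * (1 + σ * s) ^ (-(2 * a))

theorem intervalIntegrable_mass_integrand {a σ u : ℝ} (ha : 0 < a) (hu : 0 ≤ u)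
    (hpos : ∀ s ∈ Icc 0 u, 0 < 1 + σ * s) :
    IntervalIntegrable (fun s : ℝ => s ^ (a - 1) * (1 + σ * s) ^ (-(2 * a))) volume 0 u := by
  apply (intervalIntegral.intervalIntegrable_rpow' (by linarith)).mul_continuousOn
  rw [uIcc_of_le hu]
  exact ContinuousOn.rpow_const (by fun_prop) fun s hs => Or.inl (hpos s hs).ne'

theorem massIntegral_pos {a σ u : ℝ} (ha : 0 < a) (hu : 0 < u)
    (hpos : ∀ s ∈ Icc 0 u, 0 < 1 + σ * s) : 0 < massIntegral a σ u := by
  refine intervalIntegral.intervalIntegral_pos_of_pos_on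
    (intervalIntegrable_mass_integrand ha hu.le hpos) (fun s hs => ?_) hu
  exact mul_pos (rpow_pos_of_pos hs.1 _) (rpow_pos_of_pos (hpos s (Ioo_subset_Icc_self hs)) _)

theorem hasDerivAt_massIntegral {a σ u : ℝ} (ha : 0 < a) (hσ : σ ^ 2 = 1) (hu : u ∈ Ioo (0 : ℝ) 1) :
    HasDerivAt (massIntegral a σ) (u ^ (a - 1) * (1 + σ * u) ^ (-(2 * a))) u := by
  have hp : ∀ s ∈ Icc 0 u, 0 < 1 + σ * s := fun s hs =>
    one_add_mul_pos_of_sq_eq_one hσ ⟨hs.1, hs.2.trans_lt hu.2⟩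
  refine intervalIntegral.integral_hasDerivAt_right
    (intervalIntegrable_mass_integrand ha hu.1.le hp) ?_ ?_
  · exact (Measurable.stronglyMeasurable (by fun_prop)).stronglyMeasurableAtFilter
  · exact (continuousAt_id.rpow_const (Or.inl hu.1.ne')).mul
      (ContinuousAt.rpow_const (by fun_prop) (Or.inl (hp u ⟨hu.1.le, le_rfl⟩).ne'))

/-- The reciprocal of the normalized `η`, minus `a` times the primitive. -/
noncomputable def massGap (a σ u : ℝ) : ℝ :=
  u ^ a * (1 + σ * u) ^ (1 - 2 * a) / (1 - σ * u) - a * massIntegral a σ u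

theorem massGap_zero {a σ : ℝ} (ha : 0 < a) : massGap a σ 0 = 0 := by
  simp [massGap, massIntegral, ha.ne']

theorem continuousOn_massGap {a σ v : ℝ} (ha : 0 < a) (hσ : σ ^ 2 = 1) (hv : v ∈ Ico (0 : ℝ) 1) :
    ContinuousOn (massGap a σ) (Icc 0 v) := by
  have hmem : ∀ s ∈ Icc 0 v, s ∈ Ico (0 : ℝ) 1 := fun s hs => ⟨hs.1, hs.2.trans_lt hv.2⟩
  have hI := intervalIntegrable_mass_integrand ha hv.1
    fun s hs => one_add_mul_pos_of_sq_eq_one hσ (hmem s hs)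
  have hJ : ContinuousOn (massIntegral a σ) (Icc 0 v) := by
    have := intervalIntegral.continuousOn_primitive_interval' hI left_mem_uIcc
    rwa [uIcc_of_le hv.1] at this
  refine ContinuousOn.sub (ContinuousOn.div (ContinuousOn.mul ?_ ?_) (by fun_prop) ?_)
    (continuousOn_const.mul hJ)
  · exact continuousOn_id.rpow_const fun s _ => Or.inr ha.le
  · exact ContinuousOn.rpow_const (by fun_prop) fun s hs =>
      Or.inl (one_add_mul_pos_of_sq_eq_one hσ (hmem s hs)).ne'
  · exact fun s hs => (one_sub_mul_pos_of_sq_eq_one hσ (hmem s hs)).ne'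

theorem hasDerivAt_massGap {a σ u : ℝ} (ha : 0 < a) (hσ : σ ^ 2 = 1) (hu : u ∈ Ioo (0 : ℝ) 1) :
    HasDerivAt (massGap a σ)
      (σ * (2 * (u ^ a * (1 + σ * u) ^ (-(2 * a))) / (1 - σ * u) ^ 2)) u := by
  have hp := one_add_mul_pos_of_sq_eq_one hσ (Ioo_subset_Ico_self hu)
  have hq := one_sub_mul_pos_of_sq_eq_one hσ (Ioo_subset_Ico_self hu)
  have h1 : HasDerivAt (fun u : ℝ => 1 + σ * u) σ u := by
    simpa using ((hasDerivAt_id u).const_mul σ).const_add 1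
  have h2 : HasDerivAt (fun u : ℝ => 1 - σ * u) (-σ) u := by
    simpa using ((hasDerivAt_id u).const_mul σ).const_sub 1
  have h := (((hasDerivAt_rpow_const (p := a) (Or.inl hu.1.ne')).mul
    (h1.rpow_const (p := 1 - 2 * a) (Or.inl hp.ne'))).div h2 hq.ne').sub
    ((hasDerivAt_massIntegral ha hσ hu).const_mul a)
  refine h.congr_deriv ?_
  have e1 : u ^ a = u ^ (a - 1) * u := by
    rw [← rpow_add_one hu.1.ne']; ring_nf
  have e2 : (1 + σ * u) ^ (1 - 2 * a) = (1 + σ * u) ^ (-(2 * a)) * (1 + σ * u) := by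
    rw [← rpow_add_one hp.ne']; ring_nf
  have e3 : (1 + σ * u) ^ (1 - 2 * a - 1) = (1 + σ * u) ^ (-(2 * a)) := by ring_nf
  simp only [Pi.mul_apply]
  rw [e3, e2, e1]
  field_simp
  rcases sq_eq_one_iff.mp hσ with rfl | rfl <;> ring

theorem monotoneOn_mul_massGap {a σ v : ℝ} (ha : 0 < a) (hσ : σ ^ 2 = 1)
    (hv : v ∈ Ico (0 : ℝ) 1) : MonotoneOn (fun u => σ * massGap a σ u) (Icc 0 v) := by
  have hd : ∀ u ∈ interior (Icc 0 v), HasDerivAt (fun u => σ * massGap a σ u)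
      (σ * (σ * (2 * (u ^ a * (1 + σ * u) ^ (-(2 * a))) / (1 - σ * u) ^ 2))) u := by
    intro u hu
    rw [interior_Icc] at hu
    exact (hasDerivAt_massGap ha hσ ⟨hu.1, hu.2.trans hv.2⟩).const_mul σ
  refine monotoneOn_of_deriv_nonneg (convex_Icc 0 v)
    (continuousOn_const.mul (continuousOn_massGap ha hσ hv))
    (fun u hu => (hd u hu).differentiableAt.differentiableWithinAt) fun u hu => ?_
  rw [(hd u hu).deriv, ← mul_assoc, ← sq, hσ, one_mul]
  rw [interior_Icc] at hu
  have hp := one_add_mul_pos_of_sq_eq_one hσ ⟨hu.1.le, hu.2.trans hv.2⟩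
  have := hu.1
  positivity

theorem mul_massGap_le {a σ u v D C : ℝ} (ha : 0 < a) (hσ : σ ^ 2 = 1)
    (hu : 0 ≤ u) (huv : u ≤ v) (hv : v < 1) (hC : 0 ≤ C) (h : D * massGap a σ v ≤ C) :
    D * massGap a σ u ≤ C := by
  have hm := monotoneOn_mul_massGap ha hσ ⟨hu.trans huv, hv⟩
  have h0 := hm ⟨le_rfl, hu.trans huv⟩ ⟨hu, huv⟩ hu
  have h1 := hm ⟨hu, huv⟩ ⟨hu.trans huv, le_rfl⟩ huv
  simp only [massGap_zero ha, mul_zero] at h0 h1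
  have e : ∀ x, D * x = (D * σ) * (σ * x) := fun x => by linear_combination (-D * x) * hσ
  rw [e] at h ⊢
  rcases le_total (D * σ) 0 with hD | hD
  · exact (mul_nonpos_of_nonpos_of_nonneg hD h0).trans hC
  · exact (mul_le_mul_of_nonneg_left h1 hD).trans h

/-- `η` in the variable `u = |m| / (2t)`, up to a positive constant. -/
noncomputable def etaProfile (a σ u : ℝ) : ℝ :=
  u ^ (-a) * (1 + σ * u) ^ (2 * a - 1) * (1 - σ * u)

theorem etaProfile_pos {a σ u : ℝ} (hσ : σ ^ 2 = 1) (hu : u ∈ Ioo (0 : ℝ) 1) :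
    0 < etaProfile a σ u :=
  mul_pos (mul_pos (rpow_pos_of_pos hu.1 _) (rpow_pos_of_pos
    (one_add_mul_pos_of_sq_eq_one hσ (Ioo_subset_Ico_self hu)) _))
    (one_sub_mul_pos_of_sq_eq_one hσ (Ioo_subset_Ico_self hu))

theorem bracket_nonneg_iff_mul_massGap_le {a σ u C D : ℝ} (hσ : σ ^ 2 = 1)
    (hu : u ∈ Ioo (0 : ℝ) 1) :
    0 ≤ (C + D * a * massIntegral a σ u) * etaProfile a σ u - D ↔ D * massGap a σ u ≤ C := by
  have hp := one_add_mul_pos_of_sq_eq_one hσ (Ioo_subset_Ico_self hu)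
  have hq := one_sub_mul_pos_of_sq_eq_one hσ (Ioo_subset_Ico_self hu)
  have hinv : etaProfile a σ u * (u ^ a * (1 + σ * u) ^ (1 - 2 * a) / (1 - σ * u)) = 1 := by
    have e : (1 + σ * u) ^ (1 - 2 * a) = ((1 + σ * u) ^ (2 * a - 1))⁻¹ := by
      rw [← rpow_neg hp.le]; ring_nf
    have := rpow_pos_of_pos hu.1 a
    have := rpow_pos_of_pos hp (2 * a - 1)
    rw [etaProfile, e, rpow_neg hu.1.le]
    field_simp
  have : (C + D * a * massIntegral a σ u) * etaProfile a σ u - D =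
      etaProfile a σ u * (C - D * massGap a σ u) := by
    rw [massGap]
    linear_combination D * hinv
  rw [this, mul_nonneg_iff_of_pos_left (etaProfile_pos hσ hu), sub_nonneg]

theorem forall_bracket_nonneg_iff {a σ u₀ C D : ℝ} (ha : 0 < a) (hσ : σ ^ 2 = 1)
    (hu₀ : 0 < u₀) (h1 : u₀ < 1 ∨ σ = 1 ∧ u₀ = 1) :
    (∀ u ∈ Ioc 0 u₀, 0 ≤ (C + D * a * massIntegral a σ u) * etaProfile a σ u - D) ↔
      0 ≤ C ∧ 0 ≤ (C + D * a * massIntegral a σ u₀) * etaProfile a σ u₀ - D := by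
  have hle : u₀ ≤ 1 := by rcases h1 with h | h <;> [exact h.le; exact h.2.le]
  constructor
  · refine fun h => ⟨?_, h u₀ ⟨hu₀, le_rfl⟩⟩
    have hv : u₀ / 2 ∈ Ico (0 : ℝ) 1 := ⟨by linarith, by linarith⟩
    have hc := (continuousOn_massGap ha hσ hv 0 ⟨le_rfl, hv.1⟩).mono
      (Ioc_subset_Icc_self : Ioc 0 (u₀ / 2) ⊆ _)
    have ht : Tendsto (fun u => D * massGap a σ u) (nhdsWithin 0 (Ioc 0 (u₀ / 2)))
        (nhds (D * massGap a σ 0)) := hc.const_mul D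
    rw [massGap_zero ha, mul_zero, nhdsWithin_Ioc_eq_nhdsGT (by linarith)] at ht
    refine le_of_tendsto ht ?_
    filter_upwards [Ioc_mem_nhdsGT (show (0 : ℝ) < u₀ / 2 by linarith)] with u hu
    exact (bracket_nonneg_iff_mul_massGap_le hσ ⟨hu.1, by linarith [hu.2]⟩).mp
      (h u ⟨hu.1, by linarith [hu.2]⟩)
  · rintro ⟨hC, h0⟩ u ⟨hu, huu⟩
    rcases h1 with h1 | ⟨rfl, rfl⟩
    · rw [bracket_nonneg_iff_mul_massGap_le hσ ⟨hu₀, h1⟩] at h0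
      rw [bracket_nonneg_iff_mul_massGap_le hσ ⟨hu, huu.trans_lt h1⟩]
      exact mul_massGap_le ha hσ hu.le huu h1 hC h0
    · rcases huu.eq_or_lt with rfl | hlt
      · exact h0
      · rw [bracket_nonneg_iff_mul_massGap_le hσ ⟨hu, hlt⟩]
        have hD : D ≤ 0 := by simpa [etaProfile] using h0
        have hG : 0 ≤ massGap a 1 u := by
          have := monotoneOn_mul_massGap ha hσ ⟨hu.le, hlt⟩
            (left_mem_Icc.mpr hu.le) (right_mem_Icc.mpr hu.le) hu.le
          simpa [massGap_zero ha] using this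
        exact (mul_nonpos_of_nonpos_of_nonneg hD hG).trans hC

/-- α(t) ≥ 0 on [r₀, ∞) if and only if C₂ ≥ 0 and (C₂c_p + C₁a/m)η(r₀) ≥ C₁/m. -/
theorem alpha_nonneg_iff
    (p a : ℝ) (hp1 : 1 < p) (hp3 : p < 3) (ha : a = (3 - p) / (p - 1))
    (C₁ C₂ c_p m r₀ : ℝ) (hc : 0 < c_p) (hm : m ≠ 0)
    (hr₀pos : 0 < m → m / 2 ≤ r₀) (hr₀neg : m < 0 → |m| / 2 < r₀)
    (Ia : ℝ → ℝ)
    (hIa : ∀ k : ℝ, Ia k =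
      ∫ s in (0:ℝ)..|k|, s ^ (a - 1) * (1 + Real.sign k * s) ^ (-(2 * a)))
    (hmass : |m| = 2 * (c_p * Ia (m / (2 * r₀))) ^ (1 / a))
    (η α : ℝ → ℝ)
    (hη : ∀ t, η t = c_p⁻¹ * t ^ a * (1 + m / (2 * t)) ^ (2 * a - 1) * (1 - m / (2 * t)))
    (hα : ∀ t, α t = t * (1 + m / (2 * t)) ^ (2 : ℕ) *
      ((C₂ * c_p + C₁ * (a / m) * (Ia (m / (2 * t)) / Ia (m / (2 * r₀)))) * η t - C₁ / m)) :
    (∀ t ∈ Set.Ici r₀, 0 ≤ α t) ↔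
      (0 ≤ C₂ ∧ C₁ / m ≤ (C₂ * c_p + C₁ * (a / m)) * η r₀) := by
  have ha0 : 0 < a := ha ▸ div_pos (by linarith) (by linarith)
  obtain ⟨σ, hσdef⟩ : ∃ σ, σ = Real.sign m := ⟨_, rfl⟩
  have hm' : 0 < |m| := abs_pos.mpr hm
  have hσ : σ ^ 2 = 1 := by
    rcases hm.lt_or_gt with h | h
    · simp [hσdef, Real.sign_of_neg h]
    · simp [hσdef, Real.sign_of_pos h]
  have hσm : m = σ * |m| := by
    rcases hm.lt_or_gt with h | h
    · simp [hσdef, Real.sign_of_neg h, abs_of_neg h]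
    · simp [hσdef, Real.sign_of_pos h, abs_of_pos h]
  have hr₀ : |m| / 2 < r₀ ∨ σ = 1 ∧ |m| / 2 = r₀ := by
    rcases hm.lt_or_gt with h | h
    · exact Or.inl (hr₀neg h)
    · rw [abs_of_pos h]
      exact (hr₀pos h).lt_or_eq.imp_right fun e => ⟨by rw [hσdef, Real.sign_of_pos h], e⟩
  have hr₀0 : 0 < r₀ := by rcases hr₀ with h | h <;> [linarith; linarith [h.2]]
  have hk : ∀ t, m / (2 * t) = σ * (|m| / (2 * t)) := fun t => by
    rw [← mul_div_assoc, ← hσm]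
  have hI : ∀ t, 0 < t → Ia (m / (2 * t)) = massIntegral a σ (|m| / (2 * t)) := by
    intro t ht
    have h1 : |m / (2 * t)| = |m| / (2 * t) := by
      rw [abs_div, abs_of_pos (show 0 < 2 * t by linarith)]
    have h2 : Real.sign (m / (2 * t)) = σ := by
      rw [hσdef]
      rcases hm.lt_or_gt with h | h
      · rw [Real.sign_of_neg h, Real.sign_of_neg (div_neg_of_neg_of_pos h (by linarith))]
      · rw [Real.sign_of_pos h, Real.sign_of_pos (div_pos h (by linarith))]
    rw [hIa, h1, h2, massIntegral]
  obtain ⟨u₀, hu₀⟩ : ∃ u₀, u₀ = |m| / (2 * r₀) := ⟨_, rfl⟩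
  have hu₀0 : 0 < u₀ := by rw [hu₀]; positivity
  have hu₀1 : u₀ < 1 ∨ σ = 1 ∧ u₀ = 1 := by
    refine hr₀.imp (fun h => ?_) (fun h => ⟨h.1, ?_⟩)
    · rw [hu₀, div_lt_one (by linarith)]; linarith
    · rw [hu₀, div_eq_one_iff_eq (by linarith)]; linarith [h.2]
  have hpos : ∀ s ∈ Icc 0 u₀, 0 < 1 + σ * s := by
    intro s hs
    rcases hu₀1 with h | ⟨h, -⟩
    · exact one_add_mul_pos_of_sq_eq_one hσ ⟨hs.1, hs.2.trans_lt h⟩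
    · rw [h]; linarith [hs.1]
  have hJ0 := massIntegral_pos ha0 hu₀0 hpos
  obtain ⟨J, hJ⟩ : ∃ J, J = massIntegral a σ u₀ := ⟨_, rfl⟩
  rw [← hJ] at hJ0
  rw [hI r₀ hr₀0, ← hu₀, ← hJ] at hmass
  have hmass' : c_p * J = (|m| / 2) ^ a := by
    rw [hmass, mul_div_cancel_left₀ _ two_ne_zero, ← rpow_mul (by positivity),
      one_div_mul_cancel ha0.ne', rpow_one]
  have hηJ : ∀ t, 0 < t → η t = J * etaProfile a σ (|m| / (2 * t)) := by
    intro t ht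
    have h1 : t ^ a = (|m| / 2) ^ a * (|m| / (2 * t)) ^ (-a) := by
      rw [rpow_neg (by positivity), ← inv_rpow (by positivity),
        ← mul_rpow (by positivity) (by positivity)]
      congr 1
      field_simp
    rw [hη, hk, h1, ← hmass', etaProfile]
    field_simp
  have hα' : ∀ t, r₀ ≤ t → (0 ≤ α t ↔ 0 ≤ (C₂ * c_p * J + C₁ / m * a *
      massIntegral a σ (|m| / (2 * t))) * etaProfile a σ (|m| / (2 * t)) - C₁ / m) := by
    intro t ht
    have ht0 : 0 < t := hr₀0.trans_le ht
    have hp : 0 < 1 + m / (2 * t) := by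
      rw [hk]
      refine hpos _ ⟨by positivity, ?_⟩
      rw [hu₀]
      gcongr
    rw [hα, mul_nonneg_iff_of_pos_left (by positivity), hI t ht0, hI r₀ hr₀0, ← hu₀, ← hJ,
      hηJ t ht0]
    refine iff_of_eq (congrArg _ ?_)
    field_simp
  have key := forall_bracket_nonneg_iff (C := C₂ * c_p * J) (D := C₁ / m) ha0 hσ hu₀0 hu₀1
  have hC : 0 ≤ C₂ * c_p * J ↔ 0 ≤ C₂ := by
    rw [mul_nonneg_iff_of_pos_right hJ0, mul_nonneg_iff_of_pos_right hc]
  have hend : 0 ≤ (C₂ * c_p * J + C₁ / m * a * massIntegral a σ u₀) * etaProfile a σ u₀ - C₁ / m ↔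
      C₁ / m ≤ (C₂ * c_p + C₁ * (a / m)) * η r₀ := by
    rw [sub_nonneg, hηJ r₀ hr₀0, ← hu₀, ← hJ]
    refine iff_of_eq (congrArg _ ?_)
    ring
  rw [hC, hend] at key
  rw [← key]
  constructor
  · intro h u hu
    have hu0 := hu.1
    have hle : r₀ ≤ |m| / (2 * u) := by
      have := hu.2
      rw [hu₀, le_div_iff₀ (by linarith)] at this
      rw [le_div_iff₀ (by linarith)]
      linarith
    have e : |m| / (2 * (|m| / (2 * u))) = u := by field_simp
    have := (hα' _ hle).mp (h _ hle)
    rwa [e] at this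
  · intro h t ht
    have ht' : r₀ ≤ t := ht
    have ht0 : 0 < t := hr₀0.trans_le ht'
    refine (hα' t ht').mpr (h _ ⟨by positivity, ?_⟩)
    rw [hu₀]
    gcongr
end

section
/- Suppose m > 0 and r₀ = m/2 (so that m = 2(c_p·I_a(1))^{1/a}). Let α(t) = t(1+m/(2t))²·[(C₂c_p + C₁(a/m)·I_a(m/(2t))/I_a(1))·η(t) − C₁/m]. Then α(t) ≥ 0 for every t ∈ [m/2, +∞) if and only if C₂ ≥ 0 and C₁ ≤ 0. -/
open Real MeasureTheory Set Filter

lemma intervalIntegrable_rpow_mul_one_add_rpow {a : ℝ} (ha : 0 < a) {k : ℝ} (hk : 0 ≤ k) :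
    IntervalIntegrable (fun s : ℝ => s ^ (a - 1) * (1 + s) ^ (-(2 * a))) volume 0 k := by
  refine (intervalIntegral.intervalIntegrable_rpow' (by linarith)).mul_continuousOn ?_
  rw [uIcc_of_le hk]
  refine ContinuousOn.rpow_const (by fun_prop) fun x hx => Or.inl ?_
  linarith [hx.1]

lemma integral_rpow_mul_one_add_rpow_nonneg (a : ℝ) {k : ℝ} (hk : 0 ≤ k) :
    0 ≤ ∫ s in (0:ℝ)..k, s ^ (a - 1) * (1 + s) ^ (-(2 * a)) := by
  refine intervalIntegral.integral_nonneg hk fun s hs => ?_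
  have := hs.1
  positivity

lemma hasDerivAt_rpow_mul_one_add_rpow_div_one_sub (a : ℝ) {x : ℝ} (hx0 : 0 < x) (hx1 : x < 1) :
    HasDerivAt (fun x : ℝ => x ^ a * (1 + x) ^ (1 - 2 * a) / (1 - x))
      (a * (x ^ (a - 1) * (1 + x) ^ (-(2 * a)))
        + 2 * x ^ a * (1 + x) ^ (-(2 * a)) / (1 - x) ^ 2) x := by
  have h1 : HasDerivAt (fun x : ℝ => x ^ a) (a * x ^ (a - 1)) x :=
    hasDerivAt_rpow_const (Or.inl hx0.ne')
  have h2 : HasDerivAt (fun x : ℝ => (1 + x) ^ (1 - 2 * a))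
      (1 * (1 - 2 * a) * (1 + x) ^ (1 - 2 * a - 1)) x :=
    ((hasDerivAt_id' x).const_add 1).rpow_const (Or.inl (by linarith))
  have h3 : HasDerivAt (fun x : ℝ => 1 - x) (-1) x := (hasDerivAt_id' x).const_sub 1
  have hne : 1 - x ≠ 0 := by linarith
  refine ((h1.mul h2).div h3 hne).congr_deriv ?_
  have e1 : x ^ a = x ^ (a - 1) * x := by
    rw [← rpow_add_one hx0.ne', sub_add_cancel]
  have e2 : (1 + x) ^ (1 - 2 * a) = (1 + x) ^ (-(2 * a)) * (1 + x) := by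
    rw [← rpow_add_one (by linarith)]; congr 1; ring
  have e3 : 1 - 2 * a - 1 = -(2 * a) := by ring
  simp only [Pi.mul_apply]
  rw [e3, e1, e2]
  field_simp
  ring

/-- The incomplete integral is dominated by an explicit supersolution. -/
lemma mul_integral_le_rpow_mul_one_add_rpow_div {a : ℝ} (ha : 0 < a) {k : ℝ}
    (hk0 : 0 ≤ k) (hk1 : k < 1) :
    a * (∫ s in (0:ℝ)..k, s ^ (a - 1) * (1 + s) ^ (-(2 * a)))
      ≤ k ^ a * (1 + k) ^ (1 - 2 * a) / (1 - k) := by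
  have hcont : ContinuousOn (fun x : ℝ => x ^ a * (1 + x) ^ (1 - 2 * a) / (1 - x)) (Icc 0 k) := by
    refine ContinuousOn.div (ContinuousOn.mul ?_ ?_) (by fun_prop) fun x hx => ?_
    · exact (continuous_rpow_const ha.le).continuousOn
    · refine ContinuousOn.rpow_const (by fun_prop) fun x hx => Or.inl ?_
      linarith [hx.1]
    · linarith [hx.2]
  have hint : IntegrableOn (fun s : ℝ => a * (s ^ (a - 1) * (1 + s) ^ (-(2 * a)))) (Icc 0 k) := by
    rw [← intervalIntegrable_iff_integrableOn_Icc_of_le hk0]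
    exact (intervalIntegrable_rpow_mul_one_add_rpow ha hk0).const_mul a
  have key := intervalIntegral.integral_le_sub_of_hasDeriv_right_of_le hk0 hcont
    (fun x hx => (hasDerivAt_rpow_mul_one_add_rpow_div_one_sub a hx.1
      (hx.2.trans hk1)).hasDerivWithinAt) hint (fun x hx => by
        have := hx.1
        have : 0 ≤ 2 * x ^ a * (1 + x) ^ (-(2 * a)) / (1 - x) ^ 2 := by positivity
        linarith)
  simpa [intervalIntegral.integral_const_mul, zero_rpow ha.ne'] using key

lemma mul_integral_mul_one_sub_le_rpow {a : ℝ} (ha : 0 < a) {k : ℝ} (hk0 : 0 ≤ k) (hk1 : k ≤ 1) :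
    a * (∫ s in (0:ℝ)..k, s ^ (a - 1) * (1 + s) ^ (-(2 * a))) *
      ((1 + k) ^ (2 * a - 1) * (1 - k)) ≤ k ^ a := by
  rcases hk1.eq_or_lt with rfl | hk1
  · simp
  have hk : 0 < 1 - k := by linarith
  refine (mul_le_mul_of_nonneg_right (mul_integral_le_rpow_mul_one_add_rpow_div ha hk0 hk1)
    (by positivity)).trans_eq ?_
  have e : (1 + k) ^ (1 - 2 * a) * (1 + k) ^ (2 * a - 1) = 1 := by
    rw [← rpow_add (by linarith)]; simp
  field_simp
  linear_combination k ^ a * e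

theorem alpha_nonneg_iff_horizon
    (p a : ℝ) (hp1 : 1 < p) (hp3 : p < 3) (ha : a = (3 - p) / (p - 1))
    (C₁ C₂ c_p m r₀ : ℝ) (hc : 0 < c_p)
    (hmpos : 0 < m) (hr₀ : r₀ = m / 2)
    (Ia : ℝ → ℝ)
    (hIa : ∀ k : ℝ, Ia k = ∫ s in (0:ℝ)..k, s ^ (a - 1) * (1 + s) ^ (-(2 * a)))
    (hmass : m = 2 * (c_p * Ia 1) ^ (1 / a))
    (η α : ℝ → ℝ)
    (hη : ∀ t, η t = c_p⁻¹ * t ^ a * (1 + m / (2 * t)) ^ (2 * a - 1) * (1 - m / (2 * t)))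
    (hα : ∀ t, α t = t * (1 + m / (2 * t)) ^ (2 : ℕ) *
      ((C₂ * c_p + C₁ * (a / m) * (Ia (m / (2 * t)) / Ia 1)) * η t - C₁ / m)) :
    (∀ t ∈ Set.Ici (m / 2), 0 ≤ α t) ↔ (0 ≤ C₂ ∧ C₁ ≤ 0) := by
  have ha0 : 0 < a := by
    rw [ha]
    exact div_pos (by linarith) (by linarith)
  have hI0 : ∀ k, 0 ≤ k → 0 ≤ Ia k := fun k hk => by
    rw [hIa]
    exact integral_rpow_mul_one_add_rpow_nonneg a hk
  have hI1 : 0 < Ia 1 := by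
    refine (hI0 1 zero_le_one).lt_of_ne fun h => ?_
    rw [← h, mul_zero, zero_rpow (by positivity), mul_zero] at hmass
    exact hmpos.ne' hmass
  have hm : (m / 2) ^ a = c_p * Ia 1 := by
    rw [hmass, mul_div_cancel_left₀ _ two_ne_zero, ← rpow_mul (by positivity),
      one_div_mul_cancel ha0.ne', rpow_one]
  have hpos : ∀ t, m / 2 ≤ t → 0 < t := fun t ht => by linarith
  have hk0 : ∀ t, m / 2 ≤ t → 0 < m / (2 * t) := fun t ht => by
    have := hpos t ht
    positivity
  have hk1 : ∀ t, m / 2 ≤ t → m / (2 * t) ≤ 1 := fun t ht => by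
    rw [div_le_one (by linarith)]
    linarith
  have hη0 : ∀ t, m / 2 ≤ t → 0 ≤ η t := fun t ht => by
    have h1 := hpos t ht
    have h2 := hk0 t ht
    have h3 := sub_nonneg.2 (hk1 t ht)
    rw [hη]
    positivity
  have hαiff : ∀ t, m / 2 ≤ t → (0 ≤ α t ↔
      0 ≤ (C₂ * c_p + C₁ * (a / m) * (Ia (m / (2 * t)) / Ia 1)) * η t - C₁ / m) := fun t ht => by
    have h1 := hpos t ht
    have h2 := hk0 t ht
    rw [hα]
    exact mul_nonneg_iff_of_pos_left (by positivity)
  constructor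
  · intro h
    have hC1 : C₁ ≤ 0 := by
      have h1 := (hαiff (m / 2) le_rfl).1 (h _ self_mem_Ici)
      have h2 : η (m / 2) = 0 := by
        rw [hη, mul_div_cancel₀ m two_ne_zero, div_self hmpos.ne', sub_self, mul_zero]
      rw [h2, mul_zero, zero_sub, neg_nonneg, div_le_iff₀ hmpos, zero_mul] at h1
      exact h1
    refine ⟨?_, hC1⟩
    by_contra! hC2
    obtain ⟨t, ht, htm⟩ := (((tendsto_rpow_atTop ha0).eventually_gt_atTop
      (4 * (C₁ / m / C₂))).and (eventually_ge_atTop m)).exists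
    have htm' : m / 2 ≤ t := by linarith
    have ht0 := hpos t htm'
    have hk := hk0 t htm'
    have hk2 : m / (2 * t) ≤ 1 / 2 := by
      rw [div_le_iff₀ (by linarith)]
      linarith
    have hb := (hαiff t htm').1 (h t htm')
    have hneg : C₁ * (a / m) * (Ia (m / (2 * t)) / Ia 1) * η t ≤ 0 := by
      have h1 := hI0 _ hk.le
      have h2 := hη0 t htm'
      have : 0 ≤ a / m * (Ia (m / (2 * t)) / Ia 1) * η t := by positivity
      nlinarith
    have hpow : 1 / 2 ≤ (1 + m / (2 * t)) ^ (2 * a - 1) := by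
      calc (1 / 2 : ℝ) ≤ (1 + m / (2 * t)) ^ (-1 : ℝ) := by
            rw [rpow_neg_one, one_div]
            exact inv_anti₀ (by linarith) (by linarith)
        _ ≤ _ := rpow_le_rpow_of_exponent_le (by linarith) (by linarith)
    have hlow : t ^ a / 4 ≤ c_p * η t := by
      have e : c_p * η t = t ^ a * ((1 + m / (2 * t)) ^ (2 * a - 1) * (1 - m / (2 * t))) := by
        rw [hη]
        field_simp
      have h4 : (1 / 4 : ℝ) ≤ (1 + m / (2 * t)) ^ (2 * a - 1) * (1 - m / (2 * t)) := by
        nlinarith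
      have h5 : 0 < t ^ a := by positivity
      rw [e]
      nlinarith
    have hlt : C₁ / m / C₂ < c_p * η t := by linarith
    rw [div_lt_iff_of_neg hC2] at hlt
    linarith
  · rintro ⟨hC2, hC1⟩ t ht
    have ht : m / 2 ≤ t := ht
    have ht0 := hpos t ht
    rw [hαiff t ht]
    have key := mul_integral_mul_one_sub_le_rpow ha0 (hk0 t ht).le (hk1 t ht)
    rw [← hIa] at key
    have hka : (m / (2 * t)) ^ a = c_p * Ia 1 / t ^ a := by
      rw [← div_div, div_rpow (by positivity) ht0.le, hm]
    have hta : 0 < t ^ a := by positivity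
    have hle : a * (Ia (m / (2 * t)) / Ia 1) * η t ≤ 1 := by
      have e : a * (Ia (m / (2 * t)) / Ia 1) * η t =
          a * Ia (m / (2 * t)) * ((1 + m / (2 * t)) ^ (2 * a - 1) * (1 - m / (2 * t)))
            / (c_p * Ia 1 / t ^ a) := by
        rw [hη]
        generalize m / (2 * t) = k
        field_simp
      rw [e, ← hka]
      exact div_le_one_of_le₀ key (by have := hk0 t ht; positivity)
    have h1 : 0 ≤ C₂ * c_p * η t := by
      have := hη0 t ht
      positivity
    have h2 : 0 ≤ C₁ / m * (a * (Ia (m / (2 * t)) / Ia 1) * η t - 1) :=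
      mul_nonneg_of_nonpos_of_nonpos (div_nonpos_of_nonpos_of_nonneg hC1 hmpos.le) (by linarith)
    calc 0 ≤ C₂ * c_p * η t + C₁ / m * (a * (Ia (m / (2 * t)) / Ia 1) * η t - 1) := by linarith
      _ = _ := by ring
end

section
/- For every real a > 0, the integral I_a(1) = ∫₀^1 s^{a−1}(1+s)^{−2a} ds equals half of the Beta function value B(a,a); that is, ∫₀^1 s^{a−1}(1+s)^{−2a} ds = (1/2)·∫₀^{+∞} s^{a−1}(1+s)^{−2a} ds = (1/2)·∫₀^1 t^{a−1}(1−t)^{a−1} dt. -/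
open Real MeasureTheory Set Filter

lemma integrableOn_Ioo_rpow_mul_one_add_rpow {a : ℝ} (ha : 0 < a) :
    IntegrableOn (fun s : ℝ => s ^ (a - 1) * (1 + s) ^ (-(2 * a))) (Ioo 0 1) := by
  have h : IntervalIntegrable (fun s : ℝ => s ^ (a - 1) * (1 + s) ^ (-(2 * a))) volume 0 1 := by
    refine (intervalIntegral.intervalIntegrable_rpow' (by linarith)).mul_continuousOn ?_
    refine ContinuousOn.rpow_const (by fun_prop) fun x hx => Or.inl ?_
    rw [uIcc_of_le zero_le_one] at hx
    linarith [hx.1]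
  exact ((intervalIntegrable_iff_integrableOn_Ioc_of_le zero_le_one).1 h).mono_set
    Ioo_subset_Ioc_self

lemma abs_deriv_inv_smul_rpow_mul_one_add_rpow (a : ℝ) {s : ℝ} (hs : 0 < s) :
    |-(s ^ 2)⁻¹| • (s⁻¹ ^ (a - 1) * (1 + s⁻¹) ^ (-(2 * a))) =
      s ^ (a - 1) * (1 + s) ^ (-(2 * a)) := by
  have h1 : 1 + s⁻¹ = (1 + s) * s⁻¹ := by field_simp; ring
  rw [abs_neg, abs_of_pos (by positivity), h1,
    mul_rpow (by positivity) (by positivity), inv_rpow hs.le, inv_rpow hs.le,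
    ← rpow_neg hs.le, ← rpow_neg hs.le, ← rpow_natCast, ← rpow_neg hs.le, smul_eq_mul,
    show s ^ (a - 1) = s ^ (-((2 : ℕ) : ℝ)) * s ^ (-(a - 1)) * s ^ (-(-(2 * a))) by
      rw [← rpow_add hs, ← rpow_add hs]; congr 1; push_cast; ring]
  ring

lemma image_inv_Ioo_zero_one : (fun s : ℝ => s⁻¹) '' Ioo 0 1 = Ioi 1 := by
  rw [image_inv_eq_inv, inv_Ioo_0_left one_pos, inv_one]

lemma hasDerivWithinAt_inv_Ioo (s : ℝ) (hs : s ∈ Ioo (0 : ℝ) 1) :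
    HasDerivWithinAt (fun s : ℝ => s⁻¹) (-(s ^ 2)⁻¹) (Ioo 0 1) s :=
  (hasDerivAt_inv hs.1.ne').hasDerivWithinAt

lemma integrableOn_Ioi_one_rpow_mul_one_add_rpow {a : ℝ} (ha : 0 < a) :
    IntegrableOn (fun s : ℝ => s ^ (a - 1) * (1 + s) ^ (-(2 * a))) (Ioi 1) := by
  rw [← image_inv_Ioo_zero_one, integrableOn_image_iff_integrableOn_abs_deriv_smul
    measurableSet_Ioo hasDerivWithinAt_inv_Ioo inv_injective.injOn]
  exact (integrableOn_Ioo_rpow_mul_one_add_rpow ha).congr_fun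
    (fun s hs => (abs_deriv_inv_smul_rpow_mul_one_add_rpow a hs.1).symm) measurableSet_Ioo

lemma integral_Ioi_one_rpow_mul_one_add_rpow (a : ℝ) :
    ∫ s in Ioi (1 : ℝ), s ^ (a - 1) * (1 + s) ^ (-(2 * a)) =
      ∫ s in Ioo (0 : ℝ) 1, s ^ (a - 1) * (1 + s) ^ (-(2 * a)) := by
  rw [← image_inv_Ioo_zero_one, integral_image_eq_integral_abs_deriv_smul
    measurableSet_Ioo hasDerivWithinAt_inv_Ioo inv_injective.injOn]
  exact setIntegral_congr_fun measurableSet_Ioo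
    fun s hs => abs_deriv_inv_smul_rpow_mul_one_add_rpow a hs.1

lemma integral_Ioi_zero_rpow_mul_one_add_rpow {a : ℝ} (ha : 0 < a) :
    ∫ s in Ioi (0 : ℝ), s ^ (a - 1) * (1 + s) ^ (-(2 * a)) =
      2 * ∫ s in Ioo (0 : ℝ) 1, s ^ (a - 1) * (1 + s) ^ (-(2 * a)) := by
  rw [← Ioc_union_Ioi_eq_Ioi zero_le_one, setIntegral_union (Ioc_disjoint_Ioi le_rfl)
    measurableSet_Ioi
    ((integrableOn_Ioc_iff_integrableOn_Ioo (by simp)).2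
      (integrableOn_Ioo_rpow_mul_one_add_rpow ha))
    (integrableOn_Ioi_one_rpow_mul_one_add_rpow ha),
    integral_Ioi_one_rpow_mul_one_add_rpow, integral_Ioc_eq_integral_Ioo]
  ring

lemma image_div_one_add_Ioi_zero : (fun s : ℝ => s / (1 + s)) '' Ioi 0 = Ioo 0 1 := by
  ext t
  constructor
  · rintro ⟨s, hs, rfl⟩
    have hs : 0 < s := hs
    exact ⟨by positivity, (div_lt_one (by positivity)).2 (by linarith)⟩
  · rintro ⟨h0, h1⟩
    have h : 0 < 1 - t := by linarith
    refine ⟨t / (1 - t), div_pos h0 h, ?_⟩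
    field_simp
    ring

lemma injOn_div_one_add_Ioi_zero : InjOn (fun s : ℝ => s / (1 + s)) (Ioi 0) := by
  intro x hx y hy h
  have hx : 0 < x := hx
  have hy : 0 < y := hy
  have h : x / (1 + x) = y / (1 + y) := h
  rw [div_eq_div_iff (by positivity) (by positivity)] at h
  linarith

lemma integral_Ioo_rpow_mul_one_sub_rpow (a : ℝ) :
    ∫ t in Ioo (0 : ℝ) 1, t ^ (a - 1) * (1 - t) ^ (a - 1) =
      ∫ s in Ioi (0 : ℝ), s ^ (a - 1) * (1 + s) ^ (-(2 * a)) := by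
  have hd (s : ℝ) (hs : s ∈ Ioi (0 : ℝ)) :
      HasDerivWithinAt (fun s : ℝ => s / (1 + s)) ((1 + s) ^ 2)⁻¹ (Ioi 0) s := by
    have hs : 0 < s := hs
    have h := (hasDerivAt_id s).div ((hasDerivAt_id s).const_add 1)
      (show (1 : ℝ) + s ≠ 0 by positivity)
    refine (h.congr_deriv ?_).hasDerivWithinAt
    simp only [id]
    field_simp
    ring
  rw [← image_div_one_add_Ioi_zero, integral_image_eq_integral_abs_deriv_smul
    measurableSet_Ioi hd injOn_div_one_add_Ioi_zero]
  refine setIntegral_congr_fun measurableSet_Ioi fun s hs => ?_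
  have hs : 0 < s := hs
  have h1 : 0 < 1 + s := by positivity
  have h2 : 1 - s / (1 + s) = (1 + s)⁻¹ := by field_simp; ring
  simp only [smul_eq_mul]
  rw [h2, abs_of_pos (by positivity), div_rpow hs.le h1.le, inv_rpow h1.le, div_eq_mul_inv,
    ← rpow_neg h1.le, ← rpow_natCast, ← rpow_neg h1.le,
    show (1 + s) ^ (-(2 * a)) =
        (1 + s) ^ (-((2 : ℕ) : ℝ)) * (1 + s) ^ (-(a - 1)) * (1 + s) ^ (-(a - 1)) by
      rw [← rpow_add h1, ← rpow_add h1]; congr 1; push_cast; ring]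
  ring

/-- For a > 0, I_a(1) = ∫₀¹ s^{a-1}(1+s)^{-2a} ds equals half of
∫₀^∞ s^{a-1}(1+s)^{-2a} ds, which is half of the Beta function B(a,a). -/
theorem Ia_one_eq_half_beta (a : ℝ) (ha : 0 < a) :
    (∫ s in (0:ℝ)..1, s ^ (a - 1) * (1 + s) ^ (-(2 * a))) =
      (1 / 2) * ∫ s in Set.Ioi (0:ℝ), s ^ (a - 1) * (1 + s) ^ (-(2 * a)) ∧
    (∫ s in (0:ℝ)..1, s ^ (a - 1) * (1 + s) ^ (-(2 * a))) =
      (1 / 2) * ∫ t in (0:ℝ)..1, t ^ (a - 1) * (1 - t) ^ (a - 1) := by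
  simp only [intervalIntegral.integral_of_le zero_le_one, integral_Ioc_eq_integral_Ioo,
    integral_Ioo_rpow_mul_one_sub_rpow, integral_Ioi_zero_rpow_mul_one_add_rpow ha]
  constructor <;> ring
end

section
/- Let x > 0, ε, w, p be real numbers and set q := x²/(x² + ε²) ∈ (0, 1] and H := −(1/x)·((p−1)x² + ε²)/(x² + ε²)·w. Then the identity H² = (w²/x²)·[ (p−1)²q² + ((2p−3)q + 1)(1−q) ] holds, and consequently H² ≥ (w²/x²)·[ (p−1)²q² + (2p−3)q(1−q) ], i.e. H² ≥ (p−1)²·(x⁴/(x²+ε²)²)·(w²/x²) + (2p−3)·(x²/(x²+ε²))·(1 − x²/(x²+ε²))·(w²/x²). (This improved lower bound for the squared mean curvature of regularized level sets is what allows the extension of the monotonicity argument from 1 < p ≤ 2 to 1 < p < 3.) -/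
open Real MeasureTheory Set Filter

/-- Algebraic identity and improved lower bound for the squared mean curvature of
regularized level sets: with q = x²/(x²+ε²) and
H = −(1/x)((p−1)x²+ε²)/(x²+ε²)·w, one has
H² = (w²/x²)[(p−1)²q² + ((2p−3)q+1)(1−q)], hence
H² ≥ (w²/x²)[(p−1)²q² + (2p−3)q(1−q)]. -/
theorem mean_curvature_square_identity_and_bound
    (x ε w p q H : ℝ) (hx : 0 < x)
    (hq : q = x ^ (2 : ℕ) / (x ^ (2 : ℕ) + ε ^ (2 : ℕ)))
    (hH : H = -(1 / x) * (((p - 1) * x ^ (2 : ℕ) + ε ^ (2 : ℕ)) /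
      (x ^ (2 : ℕ) + ε ^ (2 : ℕ))) * w) :
    H ^ (2 : ℕ) = (w ^ (2 : ℕ) / x ^ (2 : ℕ)) *
        ((p - 1) ^ (2 : ℕ) * q ^ (2 : ℕ) + ((2 * p - 3) * q + 1) * (1 - q)) ∧
    H ^ (2 : ℕ) ≥ (w ^ (2 : ℕ) / x ^ (2 : ℕ)) *
        ((p - 1) ^ (2 : ℕ) * q ^ (2 : ℕ) + (2 * p - 3) * q * (1 - q)) ∧
    H ^ (2 : ℕ) ≥
      (p - 1) ^ (2 : ℕ) * (x ^ (4 : ℕ) / (x ^ (2 : ℕ) + ε ^ (2 : ℕ)) ^ (2 : ℕ)) *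
          (w ^ (2 : ℕ) / x ^ (2 : ℕ)) +
        (2 * p - 3) * (x ^ (2 : ℕ) / (x ^ (2 : ℕ) + ε ^ (2 : ℕ))) *
          (1 - x ^ (2 : ℕ) / (x ^ (2 : ℕ) + ε ^ (2 : ℕ))) * (w ^ (2 : ℕ) / x ^ (2 : ℕ)) := by
  have hD : 0 < x ^ 2 + ε ^ 2 := by positivity
  have hq_le : q ≤ 1 := by
    rw [hq, div_le_one hD]
    nlinarith [sq_nonneg ε]
  have hH_q : H = -(w / x) * ((p - 1) * q + (1 - q)) := by
    rw [hH, hq]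
    field_simp
    ring
  have identity : H ^ 2 = (w ^ 2 / x ^ 2) *
      ((p - 1) ^ 2 * q ^ 2 + ((2 * p - 3) * q + 1) * (1 - q)) := by
    rw [hH_q]
    ring
  have bound : H ^ 2 ≥ (w ^ 2 / x ^ 2) *
      ((p - 1) ^ 2 * q ^ 2 + (2 * p - 3) * q * (1 - q)) := by
    rw [identity]
    refine mul_le_mul_of_nonneg_left ?_ (by positivity)
    linarith
  refine ⟨identity, bound, bound.le.trans' (le_of_eq ?_)⟩
  have hq_sq : x ^ 4 / (x ^ 2 + ε ^ 2) ^ 2 = q ^ 2 := by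
    rw [hq, div_pow, ← pow_mul]
  rw [hq_sq, ← hq]
  ring
end
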